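/- arXiv:1809.09232 — 2 statements merged into one kernel-verified Lean document; each statement's English description precedes it below -/
import Mathlib

section
/- If a graph G satisfies G → (K_3)_2 and G ↛ (K_3 + K_2)_2, then G contains K_6 as a subgraph. -/
open SimpleGraph

/-- The colouring `c` contains a copy of `H` in `G` all of whose edges have colour `i`. -/
def HasMonoCopyColor {V W : Type*} (G : SimpleGraph V) (H : SimpleGraph W) {q : ℕ}
    (c : Sym2 V → Fin q) (i : Fin q) : Prop :=
  ∃ f : W ↪ V, ∀ a b, H.Adj a b → G.Adj (f a) (f b) ∧ c s(f a, f b) = i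

/-- The colouring `c` contains a monochromatic copy of `H` in `G`. -/
def HasMonoCopy {V W : Type*} (G : SimpleGraph V) (H : SimpleGraph W) {q : ℕ}
    (c : Sym2 V → Fin q) : Prop :=
  ∃ i : Fin q, HasMonoCopyColor G H c i

/-- `G` is `q`-Ramsey for `H`: every `q`-colouring of the edges of `G` contains a
monochromatic copy of `H`. -/
def IsRamsey (q : ℕ) {V W : Type*} (G : SimpleGraph V) (H : SimpleGraph W) : Prop :=
  ∀ c : Sym2 V → Fin q, HasMonoCopy G H c

/-- For every graph `S`, there is a triangle of `G` all of whose edges lie in `S` or all of whose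
edges avoid `S`. -/
def ArrowsTriangle {V : Type*} (G : SimpleGraph V) : Prop :=
  ∀ S : SimpleGraph V, ∃ x y z, G.Adj x y ∧ G.Adj y z ∧ G.Adj x z ∧
    (S.Adj x y ∧ S.Adj y z ∧ S.Adj x z ∨ ¬ S.Adj x y ∧ ¬ S.Adj y z ∧ ¬ S.Adj x z)

/-- Every edge of `R` meets every triangle of `R`. -/
def EdgesMeetTriangles {V : Type*} (R : SimpleGraph V) : Prop :=
  ∀ x y z u v, R.Adj x y → R.Adj y z → R.Adj x z → R.Adj u v →
    u = x ∨ u = y ∨ u = z ∨ v = x ∨ v = y ∨ v = z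

/-- A graph that is Ramsey for the triangle is not `5`-colourable, because `K₅` decomposes into two
pentagons. -/
theorem ArrowsTriangle.not_colorable {V : Type*} {G : SimpleGraph V} (h : ArrowsTriangle G)
    (f : V → Fin 5) : ∃ u v, G.Adj u v ∧ f u = f v := by
  by_contra! hf
  have key : ∀ a b c : Fin 5, a ≠ b → b ≠ c → a ≠ c →
      ¬ ((cycleGraph 5).Adj a b ∧ (cycleGraph 5).Adj b c ∧ (cycleGraph 5).Adj a c ∨
        ¬ (cycleGraph 5).Adj a b ∧ ¬ (cycleGraph 5).Adj b c ∧ ¬ (cycleGraph 5).Adj a c) := by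
    decide
  obtain ⟨x, y, z, hxy, hyz, hxz, hS⟩ := h ((cycleGraph 5).comap f)
  exact key _ _ _ (hf _ _ hxy) (hf _ _ hyz) (hf _ _ hxz) hS

/-- If a proper `5`-colouring `g` of a vertex cover `S` does not extend to all of `G`, then some vertex
outside `S` sees all five colours. -/
theorem ArrowsTriangle.exists_adj_all_colors {V : Type*} {G : SimpleGraph V} (hG : ArrowsTriangle G)
    {S : Set V} (g : V → Fin 5) (hg : ∀ u ∈ S, ∀ v ∈ S, G.Adj u v → g u ≠ g v)
    (hS : ∀ u v, G.Adj u v → u ∈ S ∨ v ∈ S) :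
    ∃ h ∉ S, ∀ i, ∃ s ∈ S, g s = i ∧ G.Adj h s := by
  classical
  by_contra! hcon
  choose! k hk using hcon
  obtain ⟨u, v, huv, hf⟩ := hG.not_colorable fun s => if s ∈ S then g s else k s
  by_cases hu : u ∈ S <;> by_cases hv : v ∈ S <;> simp only [hu, hv, if_true, if_false] at hf
  · exact hg u hu v hv huv hf
  · exact hk v hv u hu hf huv.symm
  · exact hk u hu v hv hf.symm huv
  · exact (hS u v huv).elim hu hv

/-- If `B` is triangle-free and the edge `xy` lies in a unique triangle of `R`, then `R ⊔ B` is not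
Ramsey for the triangle. -/
theorem not_arrowsTriangle_of_unique_page {V : Type*} {R B : SimpleGraph V}
    (hR : EdgesMeetTriangles R)
    (hB : ∀ x y z, B.Adj x y → B.Adj y z → ¬ B.Adj x z) {x y z : V} (hxy : R.Adj x y)
    (hyz : R.Adj y z) (hxz : R.Adj x z) (huniq : ∀ w, R.Adj x w → R.Adj y w → w = z) :
    ¬ ArrowsTriangle (R ⊔ B) := by
  intro h
  have hT := fun u v => hR x y z u v hxy hyz hxz
  obtain ⟨p, q, r, hpq, hqr, hpr, hS⟩ := h (SimpleGraph.fromRel fun u v =>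
    u = z ∧ v ≠ x ∧ v ≠ y ∨ R.Adj u v ∧ u ≠ z ∧ v ≠ z)
  have npq := hpq.ne
  have nqr := hqr.ne
  have npr := hpr.ne
  have nxy := hxy.ne
  have nyz := hyz.ne
  have nxz := hxz.ne
  have tpq := hT p q
  have tqr := hT q r
  have tpr := hT p r
  have bpqr := hB p q r
  have up := huniq p
  have uq := huniq q
  have ur := huniq r
  simp only [SimpleGraph.sup_adj, SimpleGraph.fromRel_adj, npq, nqr, npr, R.adj_comm q p,
    R.adj_comm r p, R.adj_comm r q, ne_eq, not_false_eq_true, true_and] at hpq hqr hpr hS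
  clear hT hB huniq hR h
  by_cases p = z
  · grind [SimpleGraph.Adj.symm]
  by_cases q = z
  · grind [SimpleGraph.Adj.symm]
  by_cases r = z
  · grind [SimpleGraph.Adj.symm]
  grind [SimpleGraph.Adj.symm]

/-- If `B` is triangle-free and every edge of `R` has its ends in `{a, b, c, d}`, then `R ⊔ B` is not
Ramsey for the triangle. -/
theorem not_arrowsTriangle_of_four_vertices {V : Type*} {R B : SimpleGraph V}
    (hB : ∀ x y z, B.Adj x y → B.Adj y z → ¬ B.Adj x z) {a b c d : V} (hab : R.Adj a b)
    (hac : a ≠ c) (had : a ≠ d) (hbc : b ≠ c) (hbd : b ≠ d) (hcd : c ≠ d)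
    (hR : ∀ u v, R.Adj u v → u = a ∨ u = b ∨ u = c ∨ u = d) :
    ¬ ArrowsTriangle (R ⊔ B) := by
  intro h
  obtain ⟨p, q, r, hpq, hqr, hpr, hS⟩ := h (SimpleGraph.fromRel fun u v =>
    (u = c ∨ u = d) ∧ (v ≠ a ∧ v ≠ b ∧ v ≠ c ∧ v ≠ d) ∨
      u = a ∧ v = b ∨ u = a ∧ v = d ∨ u = b ∧ v = c)
  have npq := hpq.ne
  have nqr := hqr.ne
  have npr := hpr.ne
  have nab := hab.ne
  have bpqr := hB p q r
  have rpq := hR p q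
  have rqp := hR q p
  have rqr := hR q r
  have rrq := hR r q
  have rpr := hR p r
  have rrp := hR r p
  simp only [SimpleGraph.sup_adj, SimpleGraph.fromRel_adj, npq, nqr, npr, ne_eq,
    not_false_eq_true, true_and] at hpq hqr hpr hS
  clear hB hR h
  by_cases p = c
  · grind
  by_cases p = d
  · grind
  by_cases q = c
  · grind
  by_cases q = d
  · grind
  by_cases r = c
  · grind
  by_cases r = d
  · grind
  grind [SimpleGraph.Adj.symm]

/-- If `R` has a triangle and `B` has none, then `R ⊔ B` is not Ramsey for the triangle. -/
theorem not_arrowsTriangle_of_triangleFree {V : Type*} {R B : SimpleGraph V}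
    (hR : EdgesMeetTriangles R)
    (hB : ∀ x y z, B.Adj x y → B.Adj y z → ¬ B.Adj x z) {x y z : V} (hxy : R.Adj x y)
    (hyz : R.Adj y z) (hxz : R.Adj x z) : ¬ ArrowsTriangle (R ⊔ B) := by
  by_cases hz : ∀ w, R.Adj x w → R.Adj y w → w = z
  · exact not_arrowsTriangle_of_unique_page hR hB hxy hyz hxz hz
  by_cases hx : ∀ w, R.Adj y w → R.Adj z w → w = x
  · exact not_arrowsTriangle_of_unique_page hR hB hyz hxz.symm hxy.symm hx
  push Not at hz hx
  obtain ⟨w, hxw, hyw, hwz⟩ := hz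
  obtain ⟨v, hyv, hzv, hvx⟩ := hx
  have hvw : v = w := by
    have := hR x y w z v hxy hyw hxw hzv
    grind [SimpleGraph.Adj.ne]
  subst hvw
  refine not_arrowsTriangle_of_four_vertices hB hxy hxz.ne hxw.ne hyz.ne hyw.ne hwz.symm (d := v) ?_
  intro u t hut
  have h1 := hR x y z u t hxy hyz hxz hut
  have h2 := hR x y v u t hxy hyw hxw hut
  have h3 := hR x z v u t hxz hzv hxw hut
  have h4 := hR y z v u t hyz hzv hyw hut
  have := hxy.ne
  have := hyz.ne
  have := hxz.ne
  have := hxw.ne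
  have := hyw.ne
  clear hR hB
  grind

/-- Two completely joined triangles form a `K₆`. -/
theorem exists_clique_of_joined_triangles {V : Type*} {G : SimpleGraph V} {x y z a b c : V}
    (hxy : G.Adj x y) (hyz : G.Adj y z) (hxz : G.Adj x z)
    (hab : G.Adj a b) (hbc : G.Adj b c) (hac : G.Adj a c)
    (h : ∀ p q, (p = x ∨ p = y ∨ p = z) → (q = a ∨ q = b ∨ q = c) → G.Adj p q) :
    ∃ f : Fin 6 → V, ∀ i j, i ≠ j → G.Adj (f i) (f j) := by
  refine ⟨![x, y, z, a, b, c], fun i j hij => ?_⟩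
  have hG := @SimpleGraph.Adj.symm _ G
  fin_cases i <;> fin_cases j <;> simp at hij ⊢ <;> grind

/-- A vertex of a triangle can be listed first. -/
theorem exists_triangle_of_mem {V : Type*} {R : SimpleGraph V} {x y z p : V}
    (hxy : R.Adj x y) (hyz : R.Adj y z) (hxz : R.Adj x z) (hp : p = x ∨ p = y ∨ p = z) :
    ∃ q r, R.Adj p q ∧ R.Adj q r ∧ R.Adj p r ∧
      ∀ s, (s = x ∨ s = y ∨ s = z) ↔ (s = p ∨ s = q ∨ s = r) := by
  rcases hp with rfl | rfl | rfl
  · exact ⟨y, z, hxy, hyz, hxz, fun _ => Iff.rfl⟩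
  · exact ⟨z, x, hyz, hxz.symm, hxy.symm, fun s => by tauto⟩
  · exact ⟨x, y, hxz.symm, hxy, hyz.symm, fun s => by tauto⟩

/-- If `R` contains a `K₄` on `x, y, z, h`, `B` contains the triangles `abc` and `hbc`, and `xb` is not
an edge, then `R ⊔ B` is not Ramsey for the triangle, because it is `5`-colourable. -/
theorem not_arrowsTriangle_of_fourClique {V : Type*} {R B : SimpleGraph V}
    (hR : EdgesMeetTriangles R) (hB : EdgesMeetTriangles B) {x y z a b c h : V}
    (hxy : R.Adj x y) (hyz : R.Adj y z) (hxz : R.Adj x z)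
    (hhx : R.Adj h x) (hhy : R.Adj h y) (hhz : R.Adj h z)
    (hab : B.Adj a b) (hbc : B.Adj b c) (hac : B.Adj a c) (hhb : B.Adj h b) (hhc : B.Adj h c)
    (hdisj : ∀ s, (s = x ∨ s = y ∨ s = z) → ¬ (s = a ∨ s = b ∨ s = c)) (hah : a ≠ h)
    (hxb : ¬ (R ⊔ B).Adj x b) : ¬ ArrowsTriangle (R ⊔ B) := by
  classical
  intro hG
  obtain ⟨u, v, huv, hf⟩ := hG.not_colorable fun s =>
    if s = x ∨ s = b then 0 else if s = y ∨ s = a then 1 else if s = c then 3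
    else if s = h then 4 else 2
  have hne := huv.ne
  have hx := hdisj x (by simp)
  have hy := hdisj y (by simp)
  have hz := hdisj z (by simp)
  have nxy := hxy.ne
  have nyz := hyz.ne
  have nxz := hxz.ne
  have nhx := hhx.ne
  have nhy := hhy.ne
  have nhz := hhz.ne
  have nab := hab.ne
  have nbc := hbc.ne
  have nac := hac.ne
  have nhb := hhb.ne
  have nhc := hhc.ne
  have hxb' : ¬ (R ⊔ B).Adj b x := fun h => hxb h.symm
  rcases huv with huv | huv
  · have h1 := hR x y z u v hxy hyz hxz huv
    have h2 := hR h x y u v hhx hxy hhy huv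
    have h3 := hR h x z u v hhx hxz hhz huv
    have h4 := hR h y z u v hhy hyz hhz huv
    have huv' : (u = x ∨ u = y ∨ u = z ∨ u = h) ∧ (v = x ∨ v = y ∨ v = z ∨ v = h) := by
      clear hf hR hB hG hdisj hxb hxb'
      grind
    clear hR hB hG hdisj h1 h2 h3 h4
    grind
  · have h1 := hB a b c u v hab hbc hac huv
    have h2 := hB h b c u v hhb hbc hhc huv
    have huv' : u = b ∨ u = c ∨ v = b ∨ v = c ∨ (u = a ∧ v = h) ∨ (u = h ∧ v = a) := by
      clear hf hR hB hG hdisj hxb hxb'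
      grind
    simp only [SimpleGraph.sup_adj, not_or] at hxb hxb'
    clear hR hB hG hdisj h1 h2
    grind

/-- Disjoint triangles `xyz` of `R` and `abc` of `B`, together with a further vertex adjacent to
`x, y, z, b, c`, force a `K₆`. -/
theorem ArrowsTriangle.exists_clique_of_common_neighbor {V : Type*} {R B : SimpleGraph V}
    (hR : EdgesMeetTriangles R) (hB : EdgesMeetTriangles B) (hG : ArrowsTriangle (R ⊔ B))
    {x y z a b c h : V}
    (hxy : R.Adj x y) (hyz : R.Adj y z) (hxz : R.Adj x z)
    (hab : B.Adj a b) (hbc : B.Adj b c) (hac : B.Adj a c)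
    (hdisj : ∀ s, (s = x ∨ s = y ∨ s = z) → ¬ (s = a ∨ s = b ∨ s = c)) (hah : a ≠ h)
    (hx : (R ⊔ B).Adj h x) (hy : (R ⊔ B).Adj h y) (hz : (R ⊔ B).Adj h z)
    (hb : (R ⊔ B).Adj h b) (hc : (R ⊔ B).Adj h c) :
    ∃ f : Fin 6 → V, ∀ i j, i ≠ j → (R ⊔ B).Adj (f i) (f j) := by
  have hred : ∀ p, (p = x ∨ p = y ∨ p = z) → (R ⊔ B).Adj h p → R.Adj h p := by
    intro p hp hhp
    have := hhp.resolve_right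
    have := hB a b c h p hab hbc hac
    grind [SimpleGraph.Adj.ne]
  have hblue : ∀ p, (p = b ∨ p = c) → (R ⊔ B).Adj h p → B.Adj h p := by
    intro p hp hhp
    have := hhp.resolve_left
    have := hR x y z h p hxy hyz hxz
    grind [SimpleGraph.Adj.ne]
  have hhx := hred x (by simp) hx
  have hhy := hred y (by simp) hy
  have hhz := hred z (by simp) hz
  have hhb := hblue b (by simp) hb
  have hhc := hblue c (by simp) hc
  by_contra hK
  have := mt (exists_clique_of_joined_triangles (G := R ⊔ B) (Or.inl hxy) (Or.inl hyz) (Or.inl hxz)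
    (Or.inr hhb) (Or.inr hbc) (Or.inr hhc)) hK
  push Not at this
  obtain ⟨p, q, hp, hq, hpq⟩ := this
  obtain ⟨p', p'', h1, h2, h3, hmem⟩ := exists_triangle_of_mem hxy hyz hxz hp
  have hadj : ∀ s, (s = p ∨ s = p' ∨ s = p'') → R.Adj h s := by
    intro s hs
    rcases (hmem s).mpr hs with rfl | rfl | rfl <;> assumption
  simp only [hmem] at hdisj
  rcases hq with rfl | rfl | rfl
  · exact hpq (Or.inl (hadj p (by simp)).symm)
  · exact not_arrowsTriangle_of_fourClique hR hB h1 h2 h3 (hadj _ (by simp)) (hadj _ (by simp))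
      (hadj _ (by simp)) hab hbc hac hhb hhc hdisj hah hpq hG
  · exact not_arrowsTriangle_of_fourClique hR hB h1 h2 h3 (hadj _ (by simp)) (hadj _ (by simp))
      (hadj _ (by simp)) hac hbc.symm hab hhc hhb (by grind) hah hpq hG

/-- Disjoint triangles of `R` and of `B` force a `K₆`. -/
theorem ArrowsTriangle.exists_clique_of_disjoint_triangles {V : Type*} {R B : SimpleGraph V}
    (hR : EdgesMeetTriangles R) (hB : EdgesMeetTriangles B) (hG : ArrowsTriangle (R ⊔ B))
    {x y z a b c : V}
    (hxy : R.Adj x y) (hyz : R.Adj y z) (hxz : R.Adj x z)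
    (hab : B.Adj a b) (hbc : B.Adj b c) (hac : B.Adj a c)
    (hdisj : ∀ s, (s = x ∨ s = y ∨ s = z) → ¬ (s = a ∨ s = b ∨ s = c)) :
    ∃ f : Fin 6 → V, ∀ i j, i ≠ j → (R ⊔ B).Adj (f i) (f j) := by
  classical
  by_contra hK
  have := mt (exists_clique_of_joined_triangles (G := R ⊔ B) (Or.inl hxy) (Or.inl hyz) (Or.inl hxz)
    (Or.inr hab) (Or.inr hbc) (Or.inr hac)) hK
  push Not at this
  obtain ⟨p, q, hp, hq, hpq⟩ := this
  obtain ⟨p', p'', hp1, hp2, hp3, hpmem⟩ := exists_triangle_of_mem hxy hyz hxz hp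
  obtain ⟨q', q'', hq1, hq2, hq3, hqmem⟩ := exists_triangle_of_mem hab hbc hac hq
  simp only [hpmem, hqmem] at hdisj
  have hred : ∀ h, h ≠ q → (R ⊔ B).Adj h p → (R ⊔ B).Adj h p' → (R ⊔ B).Adj h p'' →
      (R ⊔ B).Adj h q' → ¬ (R ⊔ B).Adj h q'' := fun h hh h1 h2 h3 h4 h5 =>
    hK (hG.exists_clique_of_common_neighbor hR hB hp1 hp2 hp3 hq1 hq2 hq3 hdisj hh.symm h1 h2 h3
      h4 h5)
  have hblue : ∀ h, h ≠ p → (R ⊔ B).Adj h q → (R ⊔ B).Adj h q' → (R ⊔ B).Adj h q'' →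
      (R ⊔ B).Adj h p' → ¬ (R ⊔ B).Adj h p'' := fun h hh h1 h2 h3 h4 h5 => by
    rw [sup_comm] at hK hG h1 h2 h3 h4 h5
    exact hK (hG.exists_clique_of_common_neighbor hB hR hq1 hq2 hq3 hp1 hp2 hp3 (by grind) hh.symm
      h1 h2 h3 h4 h5)
  have hmeet : ∀ u v, (R ⊔ B).Adj u v →
      (u = p ∨ u = p' ∨ u = p'' ∨ v = p ∨ v = p' ∨ v = p'') ∨
      (u = q ∨ u = q' ∨ u = q'' ∨ v = q ∨ v = q' ∨ v = q'') := fun u v h =>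
    h.imp (hR _ _ _ _ _ hp1 hp2 hp3) (hB _ _ _ _ _ hq1 hq2 hq3)
  have dp := hdisj p (by simp)
  have dp' := hdisj p' (by simp)
  have dp'' := hdisj p'' (by simp)
  clear hdisj
  have npp' := hp1.ne
  have np'p'' := hp2.ne
  have npp'' := hp3.ne
  have nqq' := hq1.ne
  have nq'q'' := hq2.ne
  have nqq'' := hq3.ne
  have hqp : ¬ (R ⊔ B).Adj q p := fun h => hpq h.symm
  obtain ⟨h, hh, hall⟩ := hG.exists_adj_all_colors (S := {p, p', p'', q, q', q''})
    (fun s => if s = p' then 1 else if s = p'' then 2 else if s = q' then 3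
      else if s = q'' then 4 else 0)
    (by
      intro u hu v hv huv
      have := huv.ne
      simp only [Set.mem_insert_iff, Set.mem_singleton_iff] at hu hv
      clear hred hblue hR hB hG hmeet hK hpmem hqmem
      rcases hu with rfl | rfl | rfl | rfl | rfl | rfl <;>
        rcases hv with rfl | rfl | rfl | rfl | rfl | rfl <;> grind)
    (by
      intro u v huv
      simp only [Set.mem_insert_iff, Set.mem_singleton_iff]
      rcases hmeet u v huv with (h | h | h | h | h | h) | (h | h | h | h | h | h) <;> simp [h])
  simp only [Set.mem_insert_iff, Set.mem_singleton_iff, not_or] at hh hall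
  have h0 : (R ⊔ B).Adj h p ∨ (R ⊔ B).Adj h q := by
    obtain ⟨s, hs, hsi, hadj⟩ := hall 0
    grind
  have h1 : (R ⊔ B).Adj h p' := by
    obtain ⟨s, hs, hsi, hadj⟩ := hall 1
    grind
  have h2 : (R ⊔ B).Adj h p'' := by
    obtain ⟨s, hs, hsi, hadj⟩ := hall 2
    grind
  have h3 : (R ⊔ B).Adj h q' := by
    obtain ⟨s, hs, hsi, hadj⟩ := hall 3
    grind
  have h4 : (R ⊔ B).Adj h q'' := by
    obtain ⟨s, hs, hsi, hadj⟩ := hall 4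
    grind
  rcases h0 with h0 | h0
  · exact hred h hh.2.2.2.1 h0 h1 h2 h3 h4
  · exact hblue h hh.1 h0 h3 h4 h1 h2

/-- Triangles of `R` and of `B` that share a single vertex force a `K₆`. -/
theorem ArrowsTriangle.exists_clique_of_triangles_sharing_vertex {V : Type*} {R B : SimpleGraph V}
    (hRB : Disjoint R B)
    (hR : EdgesMeetTriangles R) (hB : EdgesMeetTriangles B) (hG : ArrowsTriangle (R ⊔ B))
    {v x y a b : V}
    (hvx : R.Adj v x) (hxy : R.Adj x y) (hvy : R.Adj v y)
    (hva : B.Adj v a) (hab : B.Adj a b) (hvb : B.Adj v b) :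
    ∃ f : Fin 6 → V, ∀ i j, i ≠ j → (R ⊔ B).Adj (f i) (f j) := by
  classical
  by_contra hK
  have hRB' := SimpleGraph.disjoint_left.mp hRB
  have hxa : x ≠ a := by rintro rfl; exact hRB' _ _ hvx hva
  have hxb : x ≠ b := by rintro rfl; exact hRB' _ _ hvx hvb
  have hya : y ≠ a := by rintro rfl; exact hRB' _ _ hvy hva
  have hyb : y ≠ b := by rintro rfl; exact hRB' _ _ hvy hvb
  have nvx := hvx.ne
  have nxy := hxy.ne
  have nvy := hvy.ne
  have nva := hva.ne
  have nab := hab.ne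
  have nvb := hvb.ne
  have hfull : ∀ h, h ≠ x → h ≠ y → h ≠ a → h ≠ b → (R ⊔ B).Adj h v → (R ⊔ B).Adj h x →
      (R ⊔ B).Adj h y → (R ⊔ B).Adj h a → ¬ (R ⊔ B).Adj h b := by
    intro h n1 n2 n3 n4 hv hx hy ha hb
    have nhv := hv.ne
    have hx' : R.Adj h x := hx.resolve_right fun e => by
      have := hB _ _ _ _ _ hva hab hvb e
      grind
    have hy' : R.Adj h y := hy.resolve_right fun e => by
      have := hB _ _ _ _ _ hva hab hvb e
      grind
    have ha' : B.Adj h a := ha.resolve_left fun e => by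
      have := hR _ _ _ _ _ hvx hxy hvy e
      grind
    have hb' : B.Adj h b := hb.resolve_left fun e => by
      have := hR _ _ _ _ _ hvx hxy hvy e
      grind
    rcases hv with hv | hv
    · exact hK (hG.exists_clique_of_disjoint_triangles hR hB hvx hxy hvy ha' hab hb' (by grind))
    · exact hK (hG.exists_clique_of_disjoint_triangles hR hB hx' hxy hy' hva hab hvb (by grind))
  have hmeet : ∀ s t, (R ⊔ B).Adj s t →
      (s = v ∨ s = x ∨ s = y ∨ t = v ∨ t = x ∨ t = y) ∨
      (s = v ∨ s = a ∨ s = b ∨ t = v ∨ t = a ∨ t = b) := fun s t h =>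
    h.imp (hR _ _ _ _ _ hvx hxy hvy) (hB _ _ _ _ _ hva hab hvb)
  obtain ⟨h, hh, hall⟩ := hG.exists_adj_all_colors (S := {v, x, y, a, b})
    (fun s => if s = x then 1 else if s = y then 2 else if s = a then 3 else if s = b then 4 else 0)
    (by
      intro s hs t ht hst
      have := hst.ne
      simp only [Set.mem_insert_iff, Set.mem_singleton_iff] at hs ht
      clear hfull hR hB hG hmeet hK
      grind)
    (by
      intro s t hst
      simp only [Set.mem_insert_iff, Set.mem_singleton_iff]
      rcases hmeet s t hst with (h | h | h | h | h | h) | (h | h | h | h | h | h) <;> simp [h])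
  simp only [Set.mem_insert_iff, Set.mem_singleton_iff, not_or] at hh hall
  obtain ⟨nv, nx, ny, na, nb⟩ := hh
  have h0 : (R ⊔ B).Adj h v := by
    obtain ⟨s, hs, hsi, hadj⟩ := hall 0
    grind
  have h1 : (R ⊔ B).Adj h x := by
    obtain ⟨s, hs, hsi, hadj⟩ := hall 1
    grind
  have h2 : (R ⊔ B).Adj h y := by
    obtain ⟨s, hs, hsi, hadj⟩ := hall 2
    grind
  have h3 : (R ⊔ B).Adj h a := by
    obtain ⟨s, hs, hsi, hadj⟩ := hall 3
    grind
  have h4 : (R ⊔ B).Adj h b := by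
    obtain ⟨s, hs, hsi, hadj⟩ := hall 4
    grind
  exact hfull h nx ny na nb h0 h1 h2 h3 h4

/-- If `G = R ⊔ B` is Ramsey for the triangle, where neither `R` nor `B` contains a triangle plus a
disjoint edge, then `G` contains a `K₆`. -/
theorem ArrowsTriangle.exists_clique {V : Type*} {R B : SimpleGraph V}
    (hRB : Disjoint R B) (hR : EdgesMeetTriangles R) (hB : EdgesMeetTriangles B)
    (hG : ArrowsTriangle (R ⊔ B)) :
    ∃ f : Fin 6 → V, ∀ i j, i ≠ j → (R ⊔ B).Adj (f i) (f j) := by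
  by_cases hTB : ∀ a b c, B.Adj a b → B.Adj b c → ¬ B.Adj a c
  · obtain ⟨x, y, z, hxy, hyz, hxz, hS⟩ := hG R
    rcases hS with ⟨h1, h2, h3⟩ | ⟨h1, h2, h3⟩
    · exact absurd hG (not_arrowsTriangle_of_triangleFree hR hTB h1 h2 h3)
    · exact absurd (hxz.resolve_left h3) (hTB _ _ _ (hxy.resolve_left h1) (hyz.resolve_left h2))
  push Not at hTB
  obtain ⟨a, b, c, hab, hbc, hac⟩ := hTB
  by_cases hTR : ∀ x y z, R.Adj x y → R.Adj y z → ¬ R.Adj x z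
  · rw [sup_comm] at hG
    exact absurd hG (not_arrowsTriangle_of_triangleFree hB hTR hab hbc hac)
  push Not at hTR
  obtain ⟨x, y, z, hxy, hyz, hxz⟩ := hTR
  by_cases hdisj : ∀ s, (s = x ∨ s = y ∨ s = z) → ¬ (s = a ∨ s = b ∨ s = c)
  · exact hG.exists_clique_of_disjoint_triangles hR hB hxy hyz hxz hab hbc hac hdisj
  push Not at hdisj
  obtain ⟨v, hv, hv'⟩ := hdisj
  obtain ⟨p, q, h1, h2, h3, -⟩ := exists_triangle_of_mem hxy hyz hxz hv
  obtain ⟨r, s, h4, h5, h6, -⟩ := exists_triangle_of_mem hab hbc hac hv'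
  exact hG.exists_clique_of_triangles_sharing_vertex hRB hR hB h1 h2 h3 h4 h5 h6

/-- A graph that is `2`-Ramsey for `K₃` arrows the triangle. -/
theorem IsRamsey.arrowsTriangle {V : Type*} {G : SimpleGraph V}
    (h : IsRamsey 2 G (⊤ : SimpleGraph (Fin 3))) : ArrowsTriangle G := by
  classical
  intro S
  obtain ⟨i, f, hf⟩ := h fun e => if e ∈ S.edgeSet then 0 else 1
  have h01 := hf 0 1 (by simp)
  have h12 := hf 1 2 (by simp)
  have h02 := hf 0 2 (by simp)
  refine ⟨f 0, f 1, f 2, h01.1, h12.1, h02.1, ?_⟩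
  simp only [SimpleGraph.mem_edgeSet] at h01 h12 h02
  grind

/-- A colour class without a copy of a triangle plus a disjoint edge has all its edges meeting all
its triangles. -/
theorem edgesMeetTriangles_of_not_hasMonoCopyColor {V : Type*} {G R : SimpleGraph V} {q : ℕ}
    {c : Sym2 V → Fin q} {i : Fin q} (hR : ∀ u v, R.Adj u v → G.Adj u v ∧ c s(u, v) = i)
    (h : ¬ HasMonoCopyColor G ((⊤ : SimpleGraph (Fin 3)) ⊕g (⊤ : SimpleGraph (Fin 2))) c i) :
    EdgesMeetTriangles R := by
  intro x y z u v hxy hyz hxz huv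
  by_contra! hne
  refine h ⟨⟨Sum.elim ![x, y, z] ![u, v], ?_⟩, ?_⟩
  · have := hxy.ne
    have := hyz.ne
    have := hxz.ne
    have := huv.ne
    rintro (a | a) (b | b) hab <;> fin_cases a <;> fin_cases b <;> simp at hab ⊢ <;> grind
  · rintro (a | a) (b | b) hab
    · have hne : a ≠ b := hab
      fin_cases a <;> fin_cases b <;>
      first
        | exact (hne rfl).elim
        | exact hR x y hxy
        | exact hR y z hyz
        | exact hR x z hxz
        | exact hR y x hxy.symm
        | exact hR z y hyz.symm
        | exact hR z x hxz.symm
    · exact absurd hab Bool.false_ne_true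
    · exact absurd hab Bool.false_ne_true
    · have hne : a ≠ b := hab
      fin_cases a <;> fin_cases b <;>
      first
        | exact (hne rfl).elim
        | exact hR u v huv
        | exact hR v u huv.symm

/-- If `G → (K₃)₂` and `G ↛ (K₃ + K₂)₂` then `G` contains `K₆` as a
subgraph. -/
theorem stmt15 {V : Type} [Fintype V] (G : SimpleGraph V)
    (h1 : IsRamsey 2 G (⊤ : SimpleGraph (Fin 3)))
    (h2 : ¬ IsRamsey 2 G ((⊤ : SimpleGraph (Fin 3)) ⊕g (⊤ : SimpleGraph (Fin 2)))) :
    ∃ f : Fin 6 ↪ V, ∀ a b : Fin 6, a ≠ b → G.Adj (f a) (f b) := by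
  obtain ⟨c, hc⟩ := not_forall.mp h2
  let R : SimpleGraph V :=
    { Adj := fun u v => G.Adj u v ∧ c s(u, v) = 0
      symm := ⟨fun u v h => ⟨h.1.symm, Sym2.eq_swap ▸ h.2⟩⟩ }
  let B : SimpleGraph V :=
    { Adj := fun u v => G.Adj u v ∧ c s(u, v) = 1
      symm := ⟨fun u v h => ⟨h.1.symm, Sym2.eq_swap ▸ h.2⟩⟩ }
  have hG : R ⊔ B = G := by
    ext u v
    have : c s(u, v) = 0 ∨ c s(u, v) = 1 := by omega
    simp only [SimpleGraph.sup_adj, R, B]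
    tauto
  have hRB : Disjoint R B :=
    SimpleGraph.disjoint_left.mpr fun u v h h' => absurd (h.2.symm.trans h'.2) (by decide)
  have hmono := h1.arrowsTriangle
  rw [← hG] at hmono
  obtain ⟨f, hf⟩ := hmono.exists_clique hRB
    (edgesMeetTriangles_of_not_hasMonoCopyColor (fun _ _ h => h) fun h => hc ⟨0, h⟩)
    (edgesMeetTriangles_of_not_hasMonoCopyColor (fun _ _ h => h) fun h => hc ⟨1, h⟩)
  rw [hG] at hf
  exact ⟨⟨f, fun i j hij => by_contra fun hne => (hf i j hne).ne hij⟩, hf⟩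
end

section
/- Let k ≥ 2 and r ≥ 3 be integers. Then there exists a natural number n and graphs F_1, …, F_r, all on the same vertex set of size n and pairwise edge-disjoint, such that each F_i is (n, r, k)-critical. -/
open SimpleGraph

/-- A graph `F` on `n` vertices is `(n, r, k)`-critical if it contains no `K_{k+1}` and
every vertex subset `S` with `|S| ≥ n/r` induces a copy of `K_k`. -/
def IsCritical {V : Type*} (F : SimpleGraph V) (n r k : ℕ) : Prop :=
  F.CliqueFree (k + 1) ∧
    ∀ S : Finset V, n ≤ r * S.card → ∃ T ⊆ S, F.IsNClique k T

/-- Two points of `K³` lie on a common line of direction `x`, where the line of direction `x`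
through `(a, b, c)` is the one with parameters `y = a x - b` and `z = a y - c`. -/
def lineOf {K : Type*} [Field K] (x : K) (p : K × K × K) : K × K :=
  (p.1 * x - p.2.1, p.1 * (p.1 * x - p.2.1) - p.2.2)

lemma fst_ne_of_lineOf_eq {K : Type*} [Field K] {x : K} {p q : K × K × K}
    (h : lineOf x p = lineOf x q) (hpq : p ≠ q) : p.1 ≠ q.1 := by
  obtain ⟨a, b, c⟩ := p
  obtain ⟨a', b', c'⟩ := q
  simp only [lineOf, Prod.mk.injEq] at h
  rintro rfl
  have hb : b = b' := by linear_combination -h.1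
  subst hb
  exact hpq (by simp_all)

lemma direction_unique {K : Type*} [Field K] {x y : K} {p q : K × K × K} (hpq : p ≠ q)
    (hx : lineOf x p = lineOf x q) (hy : lineOf y p = lineOf y q) : x = y := by
  have ha := sub_ne_zero.2 (fst_ne_of_lineOf_eq hx hpq)
  simp only [lineOf, Prod.mk.injEq] at hx hy
  apply mul_left_cancel₀ ha
  linear_combination hx.1 - hy.1

/-- The point-line geometry on `K³` has no proper triangles. -/
lemma direction_eq_of_triangle {K : Type*} [Field K] {x y z : K} {p q s : K × K × K}
    (hpq : p ≠ q) (hqs : q ≠ s) (hps : p ≠ s) (hx : lineOf x p = lineOf x q)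
    (hy : lineOf y q = lineOf y s) (hz : lineOf z p = lineOf z s) : x = z := by
  have h1 := sub_ne_zero.2 (fst_ne_of_lineOf_eq hx hpq)
  have h3 := sub_ne_zero.2 (fst_ne_of_lineOf_eq hz hps)
  obtain ⟨a, b, c⟩ := p
  obtain ⟨a', b', c'⟩ := q
  obtain ⟨a'', b'', c''⟩ := s
  simp only [lineOf, Prod.mk.injEq] at *
  obtain ⟨hx1, hx2⟩ := hx
  obtain ⟨hy1, hy2⟩ := hy
  obtain ⟨hz1, hz2⟩ := hz
  have hdir : (a - a') * x + (a' - a'') * y = (a - a'') * z := by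
    linear_combination hx1 + hy1 - hz1
  have hint : (a - a') * (a' * x - b') + (a' - a'') * (a' * y - b') = (a - a'') * (a * z - b) := by
    linear_combination hx2 - a * hx1 + hy2 - a'' * hy1 - hz2 + a'' * hz1
  have hmid : a' * z - b' = a * z - b := by
    apply mul_left_cancel₀ h3
    linear_combination hint - a' * hdir
  apply mul_left_cancel₀ h1
  linear_combination hx1 + hmid

/-- A random colouring argument: if `ρ = 1 - 1 / k` and `2 ^ n * k ^ (t * |L|) * ρ ^ (t * s) < 1`
for all large `s`, some family of `k`-colourings has a rainbow fibre inside every large set. -/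
lemma exists_rainbow_colouring {ι V L : Type*} [Fintype ι] [Fintype V] [Fintype L]
    [DecidableEq ι] [DecidableEq V] [DecidableEq L] (line : ι → V → L) (k r : ℕ) (hk : 2 ≤ k)
    (h : ∀ s : ℕ, Fintype.card V ≤ r * s →
      (2 : ℝ) ^ Fintype.card V * (k : ℝ) ^ (Fintype.card ι * Fintype.card L) *
        (1 - 1 / (k : ℝ)) ^ (Fintype.card ι * s) < 1) :
    ∃ c : ι → V → Fin k, ∀ S : Finset V, Fintype.card V ≤ r * S.card →
      ∃ i l, ∀ m, ∃ p ∈ S, line i p = l ∧ c i p = m := by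
  by_contra! hbad
  have hk0 : (0 : ℝ) < k := by positivity
  set ρ : ℝ := 1 - 1 / (k : ℝ) with hρ
  let bad : Finset V × (ι × L → Fin k) → Finset (ι × V → Fin k) := fun w =>
    Fintype.piFinset fun a => if a.2 ∈ w.1 then {w.2 (a.1, line a.1 a.2)}ᶜ else Finset.univ
  let W : Finset (Finset V × (ι × L → Fin k)) :=
    Finset.univ.filter fun w => Fintype.card V ≤ r * w.1.card
  have hcover : (Finset.univ : Finset (ι × V → Fin k)) ⊆ W.biUnion bad := by
    intro c _
    obtain ⟨S, hS, hc⟩ := hbad fun i p => c (i, p)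
    choose m hm using hc
    refine Finset.mem_biUnion.2 ⟨(S, fun a => m a.1 a.2), by simpa [W] using hS, ?_⟩
    simp only [bad, Fintype.mem_piFinset]
    rintro ⟨i, p⟩
    by_cases hp : p ∈ S
    · simpa [hp] using hm i _ p hp rfl
    · simp [hp]
  have hcard : ∀ w, ((bad w).card : ℝ) =
      (k : ℝ) ^ (Fintype.card ι * Fintype.card V) * ρ ^ (Fintype.card ι * w.1.card) := by
    intro w
    have hterm : ∀ a : ι × V,
        (((if a.2 ∈ w.1 then {w.2 (a.1, line a.1 a.2)}ᶜ else Finset.univ : Finset (Fin k)).card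
          : ℕ) : ℝ) = k * if a.2 ∈ w.1 then ρ else 1 := by
      intro a
      split_ifs
      · rw [Finset.card_compl, Finset.card_singleton, Fintype.card_fin,
          Nat.cast_sub (by omega), hρ]
        field_simp
        simp
      · simp
    simp only [bad, Fintype.card_piFinset, Nat.cast_prod, hterm]
    rw [Finset.prod_mul_distrib, Finset.prod_const, Finset.card_univ, Fintype.card_prod,
      Fintype.prod_prod_type]
    simp [pow_mul']
  set N : ℝ := (2 : ℝ) ^ Fintype.card V * (k : ℝ) ^ (Fintype.card ι * Fintype.card L) with hN
  have hN0 : 0 < N := by positivity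
  set M : ℝ := (k : ℝ) ^ (Fintype.card ι * Fintype.card V) with hM
  have hM0 : 0 < M := by positivity
  have hWcard : (W.card : ℝ) ≤ N := by
    have : W.card ≤ 2 ^ Fintype.card V * k ^ (Fintype.card ι * Fintype.card L) := by
      refine (Finset.card_le_univ W).trans_eq ?_
      simp
    rw [hN]
    exact_mod_cast this
  have hle : M ≤ ∑ w ∈ W, ((bad w).card : ℝ) := by
    have h1 := (Finset.card_le_card hcover).trans Finset.card_biUnion_le
    have h2 : (Finset.univ : Finset (ι × V → Fin k)).card
        = k ^ (Fintype.card ι * Fintype.card V) := by simp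
    rw [h2] at h1
    rw [hM]
    exact_mod_cast h1
  have hlt : ∀ w ∈ W, ((bad w).card : ℝ) < M / N := by
    intro w hw
    have h1 := h w.1.card (Finset.mem_filter.1 hw).2
    rw [hcard, lt_div_iff₀ hN0]
    nlinarith
  have hWne : W.Nonempty := by
    by_contra hW
    rw [Finset.not_nonempty_iff_eq_empty] at hW
    rw [hW, Finset.sum_empty] at hle
    linarith
  have h1 := Finset.sum_lt_sum_of_nonempty hWne hlt
  rw [Finset.sum_const, nsmul_eq_mul] at h1
  have h2 : (W.card : ℝ) * (M / N) ≤ N * (M / N) := by gcongr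
  rw [mul_div_cancel₀ _ hN0.ne'] at h2
  linarith

/-- Points are adjacent when they lie on a common line whose direction belongs to the family `d`
and receive different colours in the colouring attached to that direction. -/
def lineGraph {K ι : Type*} [Field K] {k : ℕ} (d : ι → K) (c : ι → K × K × K → Fin k) :
    SimpleGraph (K × K × K) where
  Adj p q := ∃ i, lineOf (d i) p = lineOf (d i) q ∧ c i p ≠ c i q
  symm := ⟨fun _ _ ⟨i, h, hc⟩ => ⟨i, h.symm, hc.symm⟩⟩
  loopless := ⟨fun _ ⟨_, _, hc⟩ => hc rfl⟩

lemma lineGraph_cliqueFree {K ι : Type*} [Field K] {k : ℕ} (hk : 1 ≤ k) {d : ι → K}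
    (hd : Function.Injective d) (c : ι → K × K × K → Fin k) :
    (lineGraph d c).CliqueFree (k + 1) := by
  classical
  intro T hT
  obtain ⟨p, hp, q, hq, hpq⟩ := Finset.one_lt_card.1 (by rw [hT.card_eq]; omega)
  obtain ⟨i, hi, -⟩ := hT.isClique hp hq hpq
  have hline : ∀ s ∈ T, lineOf (d i) p = lineOf (d i) s := by
    intro s hs
    by_cases hps : p = s
    · rw [hps]
    by_cases hqs : q = s
    · rw [← hqs, hi]
    obtain ⟨j, hj, -⟩ := hT.isClique hp hs hps
    obtain ⟨l, hl, -⟩ := hT.isClique hq hs hqs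
    rwa [direction_eq_of_triangle hpq hqs hps hi hl hj]
  have hinj : Set.InjOn (c i) T := by
    intro s hs t ht hst
    by_contra hne
    obtain ⟨j, hj, hcj⟩ := hT.isClique hs ht hne
    have hij := hd (direction_unique hne hj ((hline s hs).symm.trans (hline t ht)))
    exact hcj (hij ▸ hst)
  have := Finset.card_le_card_of_injOn (c i) (fun _ _ => Finset.mem_univ _) hinj
  rw [hT.card_eq, Finset.card_univ, Fintype.card_fin] at this
  omega

lemma exists_isCritical_lineGraph {K ι : Type*} [Field K] [Fintype K] [Fintype ι]
    (k r : ℕ) (hk : 2 ≤ k) {d : ι → K} (hd : Function.Injective d)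
    (h : ∀ s : ℕ, Fintype.card (K × K × K) ≤ r * s →
      (2 : ℝ) ^ Fintype.card (K × K × K) * (k : ℝ) ^ (Fintype.card ι * Fintype.card (K × K)) *
        (1 - 1 / (k : ℝ)) ^ (Fintype.card ι * s) < 1) :
    ∃ c : ι → K × K × K → Fin k,
      IsCritical (lineGraph d c) (Fintype.card (K × K × K)) r k := by
  classical
  obtain ⟨c, hc⟩ := exists_rainbow_colouring (fun i => lineOf (d i)) k r hk h
  refine ⟨c, lineGraph_cliqueFree (by omega) hd c, fun S hS => ?_⟩
  obtain ⟨i, l, hl⟩ := hc S hS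
  choose f hfS hfl hfc using hl
  have hf : Function.Injective f := fun a b hab => by rw [← hfc a, ← hfc b, hab]
  refine ⟨Finset.univ.image f, ?_, ?_, ?_⟩
  · simpa [Finset.image_subset_iff] using hfS
  · intro p hp q hq hpq
    simp only [Finset.coe_image, Finset.coe_univ, Set.image_univ, Set.mem_range] at hp hq
    obtain ⟨a, rfl⟩ := hp
    obtain ⟨b, rfl⟩ := hq
    refine ⟨i, (hfl a).trans (hfl b).symm, ?_⟩
    rw [hfc, hfc]
    rintro rfl
    exact hpq rfl
  · rw [Finset.card_image_of_injective _ hf, Finset.card_univ, Fintype.card_fin]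

lemma IsCritical.comap_equiv {V W : Type*} (e : W ≃ V) {F : SimpleGraph V} {n r k : ℕ}
    (hF : IsCritical F n r k) : IsCritical (F.comap e) n r k := by
  refine ⟨hF.1.comap ⟨(SimpleGraph.Embedding.comap e.toEmbedding F).toCopy⟩, fun S hS => ?_⟩
  obtain ⟨T, hTS, hT⟩ := hF.2 (S.map e.toEmbedding) (by rwa [Finset.card_map])
  refine ⟨T.map e.symm.toEmbedding, ?_, ?_, ?_⟩
  · intro x hx
    obtain ⟨y, hy, rfl⟩ := Finset.mem_map.1 hx
    obtain ⟨z, hz, rfl⟩ := Finset.mem_map.1 (hTS hy)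
    simpa using hz
  · intro x hx y hy hxy
    simp only [Finset.coe_map, Set.mem_image, Finset.mem_coe] at hx hy
    obtain ⟨u, hu, rfl⟩ := hx
    obtain ⟨v, hv, rfl⟩ := hy
    have huv : u ≠ v := fun huv => hxy (huv ▸ rfl)
    simpa using hT.isClique hu hv huv
  · rw [Finset.card_map, hT.card_eq]

lemma union_bound_lt_one {k r t q : ℕ} (hk : 2 ≤ k) (hr : r ≠ 0) (hq : q ≠ 0)
    (ht : (2 : ℝ) ^ r * (1 - 1 / (k : ℝ)) ^ t < 1 / 2) (hkq : (k : ℝ) ^ (r * t) < 2 ^ q)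
    {s : ℕ} (hs : q * (q * q) ≤ r * s) :
    (2 : ℝ) ^ (q * (q * q)) * (k : ℝ) ^ (t * (q * q)) * (1 - 1 / (k : ℝ)) ^ (t * s) < 1 := by
  have hk1 : 1 / (k : ℝ) ≤ 1 := by
    rw [div_le_one (by positivity)]
    exact_mod_cast (by omega : 1 ≤ k)
  set ρ : ℝ := 1 - 1 / (k : ℝ) with hρ
  have hρ0 : 0 ≤ ρ := by linarith
  have hρ1 : ρ ≤ 1 := by
    have : 0 ≤ 1 / (k : ℝ) := by positivity
    linarith
  refine (pow_lt_one_iff_of_nonneg (by positivity) hr).1 ?_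
  calc ((2 : ℝ) ^ (q * (q * q)) * (k : ℝ) ^ (t * (q * q)) * ρ ^ (t * s)) ^ r
      = (2 : ℝ) ^ (r * (q * (q * q))) * (k : ℝ) ^ (r * t * (q * q)) * ρ ^ (t * (r * s)) := by
        rw [mul_pow, mul_pow, ← pow_mul, ← pow_mul, ← pow_mul]
        congr 2 <;> ring_nf
    _ ≤ (2 : ℝ) ^ (r * (q * (q * q))) * (k : ℝ) ^ (r * t * (q * q)) * ρ ^ (t * (q * (q * q))) := by
        gcongr ?_ * ?_
        exact pow_le_pow_of_le_one hρ0 hρ1 (Nat.mul_le_mul_left t hs)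
    _ = ((2 ^ r * ρ ^ t) ^ q * (k : ℝ) ^ (r * t)) ^ (q * q) := by
        rw [mul_pow, ← pow_mul, ← pow_mul, mul_pow, ← pow_mul, ← pow_mul]
        ring_nf
    _ < 1 := by
        refine pow_lt_one₀ (by positivity) ?_ (by positivity)
        calc (2 ^ r * ρ ^ t) ^ q * (k : ℝ) ^ (r * t)
            ≤ (1 / 2) ^ q * (k : ℝ) ^ (r * t) := by gcongr
          _ < (1 / 2) ^ q * 2 ^ q := by gcongr
          _ = 1 := by rw [← mul_pow]; norm_num

/-- For `k ≥ 2` and `r ≥ 3` there exist `n` and a colour pattern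
`F 0, …, F (r-1)` of pairwise edge-disjoint graphs on `n` common vertices, each of which
is `(n, r, k)`-critical. -/
theorem stmt16 (k r : ℕ) (hk : 2 ≤ k) (hr : 3 ≤ r) :
    ∃ (n : ℕ) (F : Fin r → SimpleGraph (Fin n)),
      (∀ i j : Fin r, i ≠ j → ∀ x y : Fin n, (F i).Adj x y → ¬ (F j).Adj x y) ∧
      ∀ i : Fin r, IsCritical (F i) n r k := by
  have hρ1 : 1 - 1 / (k : ℝ) < 1 := by
    have : 0 < 1 / (k : ℝ) := by positivity
    linarith
  obtain ⟨t, ht⟩ := exists_pow_lt_of_lt_one (by positivity : (0 : ℝ) < 1 / 2 / 2 ^ r) hρ1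
  rw [lt_div_iff₀' (by positivity)] at ht
  obtain ⟨q₀, hq₀⟩ := pow_unbounded_of_one_lt ((k : ℝ) ^ (r * t)) one_lt_two
  obtain ⟨q, hq, hprime⟩ := Nat.exists_infinite_primes (max q₀ (r * t))
  have : Fact q.Prime := ⟨hprime⟩
  have hkq : (k : ℝ) ^ (r * t) < 2 ^ q :=
    hq₀.trans_le (pow_le_pow_right₀ one_le_two ((le_max_left _ _).trans hq))
  obtain ⟨d⟩ : Nonempty (Fin r × Fin t ↪ ZMod q) :=
    Function.Embedding.nonempty_of_card_le (by
      simpa [ZMod.card] using (le_max_right _ _).trans hq)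
  have hd : ∀ i : Fin r, Function.Injective fun j : Fin t => d (i, j) := fun i a b hab =>
    (Prod.ext_iff.1 (d.injective hab)).2
  have hcrit := fun i => exists_isCritical_lineGraph k r hk (hd i) (by
    simpa [ZMod.card] using
      fun s => union_bound_lt_one (s := s) hk (by omega) hprime.ne_zero ht hkq)
  choose c hc using hcrit
  let e := (Fintype.equivFin (ZMod q × ZMod q × ZMod q)).symm
  refine ⟨_, fun i => (lineGraph (fun j => d (i, j)) (c i)).comap e, ?_,
    fun i => (hc i).comap_equiv e⟩
  rintro i j hij x y ⟨a, ha, hca⟩ ⟨b, hb, -⟩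
  have hne : e x ≠ e y := fun h => hca (by rw [h])
  exact hij (Prod.ext_iff.1 (d.injective (direction_unique hne ha hb))).1
end
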